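/- Sufficient condition for contraction: fix A ∈ F. If Σ_{j : E_j ≠ ∅} B_low(A|E_j) · q_j ≥ 𝒫_low(A) and Σ_{j : E_j ≠ ∅} B_up(A|E_j) · q_j ≤ 𝒫_up(A), then the updated set contracts at A, i.e., 𝒫'_low(A) ≥ 𝒫_low(A) and 𝒫'_up(A) ≤ 𝒫_up(A). -/

import Mathlib

open MeasureTheory Finset
open scoped Classical

variable {Ω : Type*} [MeasurableSpace Ω]

/-- Lower probability of a set of probability measures: `𝒬_low(A) := inf_{P ∈ 𝒬} P(A)`. -/
noncomputable def lowProb (𝒮 : Set (Measure Ω)) (A : Set Ω) : ℝ :=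
  ⨅ P : 𝒮, ((P : Measure Ω) A).toReal

/-- Upper probability of a set of probability measures: `𝒬_up(A) := sup_{P ∈ 𝒬} P(A)`. -/
noncomputable def upProb (𝒮 : Set (Measure Ω)) (A : Set Ω) : ℝ :=
  ⨆ P : 𝒮, ((P : Measure Ω) A).toReal

/-- The Jeffrey (DPK) update of `P` with respect to the partition `E` and weights `q`:
`P'(A) := ∑_{j : E_j ≠ ∅} (P(A ∩ E_j)/P(E_j)) · q_j`. -/
noncomputable def jUpdate (P : Measure Ω) {m : ℕ} (E : Fin m → Set Ω)
    (q : Fin m → ℝ) (A : Set Ω) : ℝ :=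
  ∑ j ∈ Finset.univ.filter (fun j => E j ≠ ∅),
    ((P (A ∩ E j)).toReal / (P (E j)).toReal) * q j

/-- Lower probability of the updated set `𝒮' = {P' : P ∈ 𝒮}`. -/
noncomputable def jLow (𝒮 : Set (Measure Ω)) {m : ℕ} (E : Fin m → Set Ω)
    (q : Fin m → ℝ) (A : Set Ω) : ℝ :=
  ⨅ P : 𝒮, jUpdate (P : Measure Ω) E q A

/-- Upper probability of the updated set `𝒮' = {P' : P ∈ 𝒮}`. -/
noncomputable def jUp (𝒮 : Set (Measure Ω)) {m : ℕ} (E : Fin m → Set Ω)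
    (q : Fin m → ℝ) (A : Set Ω) : ℝ :=
  ⨆ P : 𝒮, jUpdate (P : Measure Ω) E q A

/-- Generalized Bayes conditional lower probability:
`B_low(A|B) := inf_{P ∈ 𝒮} P(A ∩ B)/P(B)`. -/
noncomputable def bayesLow (𝒮 : Set (Measure Ω)) (A B : Set Ω) : ℝ :=
  ⨅ P : 𝒮, ((P : Measure Ω) (A ∩ B)).toReal / ((P : Measure Ω) B).toReal

/-- Generalized Bayes conditional upper probability:
`B_up(A|B) := sup_{P ∈ 𝒮} P(A ∩ B)/P(B)`. -/
noncomputable def bayesUp (𝒮 : Set (Measure Ω)) (A B : Set Ω) : ℝ :=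
  ⨆ P : 𝒮, ((P : Measure Ω) (A ∩ B)).toReal / ((P : Measure Ω) B).toReal

/-- Geometric conditional lower probability: `G_low(A|B) := 𝒮_low(A ∩ B)/𝒮_low(B)`. -/
noncomputable def geomLow (𝒮 : Set (Measure Ω)) (A B : Set Ω) : ℝ :=
  lowProb 𝒮 (A ∩ B) / lowProb 𝒮 B

/-- Geometric conditional upper probability: `G_up(A|B) := 𝒮_up(A ∩ B)/𝒮_up(B)`. -/
noncomputable def geomUp (𝒮 : Set (Measure Ω)) (A B : Set Ω) : ℝ :=
  upProb 𝒮 (A ∩ B) / upProb 𝒮 B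

theorem condRatio_nonneg (P : Measure Ω) (A B : Set Ω) :
    0 ≤ (P (A ∩ B)).toReal / (P B).toReal :=
  div_nonneg ENNReal.toReal_nonneg ENNReal.toReal_nonneg

theorem condRatio_le_one (P : Measure Ω) [IsFiniteMeasure P] (A B : Set Ω) :
    (P (A ∩ B)).toReal / (P B).toReal ≤ 1 :=
  div_le_one_of_le₀
    (ENNReal.toReal_mono (measure_ne_top P B) (measure_mono Set.inter_subset_right))
    ENNReal.toReal_nonneg

theorem bayesLow_le (𝒮 : Set (Measure Ω)) (A B : Set Ω) (P : 𝒮) :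
    bayesLow 𝒮 A B ≤ ((P : Measure Ω) (A ∩ B)).toReal / ((P : Measure Ω) B).toReal :=
  ciInf_le ⟨0, by rintro _ ⟨Q, rfl⟩; exact condRatio_nonneg _ A B⟩ P

theorem le_bayesUp (𝒮 : Set (Measure Ω)) (h𝒮 : ∀ P ∈ 𝒮, IsFiniteMeasure P)
    (A B : Set Ω) (P : 𝒮) :
    ((P : Measure Ω) (A ∩ B)).toReal / ((P : Measure Ω) B).toReal ≤ bayesUp 𝒮 A B := by
  refine le_ciSup
    (f := fun Q : 𝒮 => ((Q : Measure Ω) (A ∩ B)).toReal / ((Q : Measure Ω) B).toReal)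
    ⟨1, ?_⟩ P
  rintro _ ⟨Q, rfl⟩
  have := h𝒮 Q Q.2
  exact condRatio_le_one _ A B

/-- sufficient condition for contraction at `A`: if
`∑ B_low(A|E_j) q_j ≥ 𝒮_low(A)` and `∑ B_up(A|E_j) q_j ≤ 𝒮_up(A)`, then the updated set
contracts at `A`: `𝒮'_low(A) ≥ 𝒮_low(A)` and `𝒮'_up(A) ≤ 𝒮_up(A)`. -/
theorem contraction_sufficient
    (𝒮 : Set (Measure Ω)) (h𝒮ne : 𝒮.Nonempty)
    (h𝒮prob : ∀ P ∈ 𝒮, IsProbabilityMeasure P)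
    {m : ℕ} (E : Fin m → Set Ω) (hEmeas : ∀ j, MeasurableSet (E j))
    (hEdisj : Pairwise (Function.onFun Disjoint E))
    (hEcover : (⋃ j, E j) = Set.univ)
    (q : Fin m → ℝ) (hq0 : ∀ j, 0 ≤ q j) (hq1 : ∑ j, q j = 1)
    (hqempty : ∀ j, E j = ∅ → q j = 0)
    (hpos : ∀ P ∈ 𝒮, ∀ j, E j ≠ ∅ → 0 < (P : Measure Ω) (E j))
    (A : Set Ω) (hA : MeasurableSet A)
    (h1 : lowProb 𝒮 A
      ≤ ∑ j ∈ Finset.univ.filter (fun j => E j ≠ ∅), bayesLow 𝒮 A (E j) * q j)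
    (h2 : (∑ j ∈ Finset.univ.filter (fun j => E j ≠ ∅), bayesUp 𝒮 A (E j) * q j)
      ≤ upProb 𝒮 A) :
    lowProb 𝒮 A ≤ jLow 𝒮 E q A ∧ jUp 𝒮 E q A ≤ upProb 𝒮 A := by
  have : Nonempty 𝒮 := h𝒮ne.to_subtype
  have h𝒮fin : ∀ P ∈ 𝒮, IsFiniteMeasure P := fun P hP => by
    have := h𝒮prob P hP
    infer_instance
  constructor
  · exact le_ciInf fun P => h1.trans <| Finset.sum_le_sum fun j _ =>
      mul_le_mul_of_nonneg_right (bayesLow_le 𝒮 A (E j) P) (hq0 j)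
  · exact ciSup_le fun P => le_trans (Finset.sum_le_sum fun j _ =>
      mul_le_mul_of_nonneg_right (le_bayesUp 𝒮 h𝒮fin A (E j) P) (hq0 j)) h2
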